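/- arXiv:1807.11403 — 5 statements merged into one kernel-verified Lean document; each statement's English description precedes it below -/
import Mathlib

section
/- Let C be a braided monoidal category, ⊕ : C × C → C a bifunctor, and δ_{A,B,C} : A⊗(B⊕C) ≅ (A⊗B)⊕(A⊗C) a family of isomorphisms natural in A, B, C satisfying Condition VI. Then Laplaza's Condition VII holds: for all objects A, B, C, D of C, α_{C⊕D,B,A} ≫ δ#_{C,D,B⊗A} = (δ#_{C,D,B} ⊗ 1_A) ≫ δ#_{C⊗B,D⊗B,A} ≫ (α_{C,B,A} ⊕ α_{D,B,A}), as morphisms ((C⊕D)⊗B)⊗A → (C⊗(B⊗A))⊕(D⊗(B⊗A)). -/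
open CategoryTheory Category MonoidalCategory

/-- The right-distributivity morphism `δ#_{A,B,X} : (A⊕B)⊗X ⟶ (A⊗X)⊕(B⊗X)`,
defined from left distributivity and the braiding as
`γ_{A⊕B,X} ≫ δ_{X,A,B} ≫ (γ_{A,X}⁻¹ ⊕ γ_{B,X}⁻¹)`. -/
noncomputable def deltaSharp {𝒞 : Type*} [Category 𝒞] [MonoidalCategory 𝒞] [BraidedCategory 𝒞]
    (P : 𝒞 × 𝒞 ⥤ 𝒞)
    (δ : ∀ A B X : 𝒞, A ⊗ P.obj (B, X) ≅ P.obj (A ⊗ B, A ⊗ X))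
    (A B X : 𝒞) : P.obj (A, B) ⊗ X ⟶ P.obj (A ⊗ X, B ⊗ X) :=
  (β_ (P.obj (A, B)) X).hom ≫ (δ X A B).hom ≫ P.map ((β_ A X).inv, (β_ B X).inv)

/-- The two ways of moving `X` past `Y ⊗ Z` while reversing `Y` and `Z` agree. -/
theorem braiding_whiskerRight_comp_braiding_tensor {𝒞 : Type*} [Category 𝒞] [MonoidalCategory 𝒞]
    [BraidedCategory 𝒞] (X Y Z : 𝒞) :
    (β_ X Y).hom ▷ Z ≫ (β_ (Y ⊗ X) Z).hom
      = (α_ X Y Z).hom ≫ (β_ X (Y ⊗ Z)).hom ≫ (β_ Y Z).hom ▷ X ≫ (α_ Z Y X).hom := by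
  simp [BraidedCategory.braiding_tensor_left_hom, BraidedCategory.braiding_tensor_right_hom]

theorem whiskerLeft_braiding_inv_comp_braiding_tensor_inv {𝒞 : Type*} [Category 𝒞]
    [MonoidalCategory 𝒞] [BraidedCategory 𝒞] (X Y Z : 𝒞) :
    Z ◁ (β_ X Y).inv ≫ (β_ (X ⊗ Y) Z).inv ≫ (α_ X Y Z).hom
      = (α_ Z Y X).inv ≫ (β_ Y Z).inv ▷ X ≫ (β_ X (Y ⊗ Z)).inv := by
  rw [← cancel_epi ((β_ X Y).hom ▷ Z ≫ (β_ (Y ⊗ X) Z).hom)]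
  conv_rhs => rw [braiding_whiskerRight_comp_braiding_tensor]
  rw [assoc, ← BraidedCategory.braiding_naturality_left_assoc]
  simp only [assoc, Iso.hom_inv_id_assoc, hom_inv_whiskerRight_assoc, Iso.hom_inv_id, comp_id]

/-- Laplaza's Condition VII follows from Condition VI in a braided monoidal category. -/
theorem laplaza_VII_of_VI {𝒞 : Type*} [Category 𝒞] [MonoidalCategory 𝒞] [BraidedCategory 𝒞]
    (P : 𝒞 × 𝒞 ⥤ 𝒞)
    (δ : ∀ A B X : 𝒞, A ⊗ P.obj (B, X) ≅ P.obj (A ⊗ B, A ⊗ X))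
    (δ_nat : ∀ {A A' B B' X X' : 𝒞} (a : A ⟶ A') (b : B ⟶ B') (x : X ⟶ X'),
      MonoidalCategory.tensorHom a (P.map (b, x)) ≫ (δ A' B' X').hom
        = (δ A B X).hom ≫ P.map (MonoidalCategory.tensorHom a b, MonoidalCategory.tensorHom a x))
    (condVI : ∀ A B X Y : 𝒞,
      (δ (A ⊗ B) X Y).hom ≫ P.map ((α_ A B X).hom, (α_ A B Y).hom)
        = (α_ A B (P.obj (X, Y))).hom ≫ MonoidalCategory.tensorHom (𝟙 A) (δ B X Y).hom ≫ (δ A (B ⊗ X) (B ⊗ Y)).hom)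
    (A B C D : 𝒞) :
    (α_ (P.obj (C, D)) B A).hom ≫ deltaSharp P δ C D (B ⊗ A)
      = MonoidalCategory.tensorHom (deltaSharp P δ C D B) (𝟙 A)
          ≫ deltaSharp P δ (C ⊗ B) (D ⊗ B) A
          ≫ P.map ((α_ C B A).hom, (α_ D B A).hom) := by
  simp only [id_tensorHom] at condVI
  have map_comp : ∀ {X X' X'' Y Y' Y'' : 𝒞} (f : X ⟶ X') (f' : X' ⟶ X'') (g : Y ⟶ Y')
      (g' : Y' ⟶ Y''), P.map (X := (X, Y)) (Y := (X'', Y'')) (f ≫ f', g ≫ g')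
        = P.map (X := (X, Y)) (Y := (X', Y')) (f, g) ≫ P.map (f', g') :=
    fun {X X' X'' Y Y' Y''} f f' g g' =>
      P.map_comp (X := (X, Y)) (Y := (X', Y')) (Z := (X'', Y'')) (f, g) (f', g')
  have δ_nat_left : ∀ {X X' : 𝒞} (f : X ⟶ X'),
      f ▷ P.obj (C, D) ≫ (δ X' C D).hom = (δ X C D).hom ≫ P.map (f ▷ C, f ▷ D) := by
    intro X X' f
    have h := δ_nat f (𝟙 C) (𝟙 D)
    have h_id : P.map ((𝟙 C, 𝟙 D) : (C, D) ⟶ (C, D)) = 𝟙 _ := P.map_id _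
    rwa [h_id, tensorHom_id, tensorHom_id, tensorHom_id] at h
  have δ_nat_right : ∀ {X X' Y Y' : 𝒞} (f : X ⟶ X') (g : Y ⟶ Y'),
      A ◁ P.map (f, g) ≫ (δ A X' Y').hom = (δ A X Y).hom ≫ P.map (A ◁ f, A ◁ g) := by
    intro X X' Y Y' f g
    simpa only [id_tensorHom] using δ_nat (𝟙 A) f g
  have VI : A ◁ (δ B C D).hom ≫ (δ A (B ⊗ C) (B ⊗ D)).hom
      = (α_ A B _).inv ≫ (δ (A ⊗ B) C D).hom ≫ P.map ((α_ A B C).hom, (α_ A B D).hom) := by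
    rw [condVI, Iso.inv_hom_id_assoc]
  symm
  calc
    _ = ((β_ (P.obj (C, D)) B).hom ▷ A ≫ (β_ _ A).hom) ≫
          (A ◁ (δ B C D).hom ≫ (δ A _ _).hom) ≫
          P.map (A ◁ (β_ C B).inv ≫ (β_ (C ⊗ B) A).inv ≫ (α_ C B A).hom,
            A ◁ (β_ D B).inv ≫ (β_ (D ⊗ B) A).inv ≫ (α_ D B A).hom) := by
      simp only [deltaSharp, tensorHom_id, comp_whiskerRight, assoc, map_comp,
        BraidedCategory.braiding_naturality_left_assoc, reassoc_of% δ_nat_right]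
    _ = (α_ _ B A).hom ≫ (β_ _ (B ⊗ A)).hom ≫
          ((β_ B A).hom ▷ P.obj (C, D) ≫ (δ (A ⊗ B) C D).hom) ≫
          P.map ((β_ B A).inv ▷ C ≫ (β_ C (B ⊗ A)).inv,
            (β_ B A).inv ▷ D ≫ (β_ D (B ⊗ A)).inv) := by
      rw [braiding_whiskerRight_comp_braiding_tensor, VI,
        whiskerLeft_braiding_inv_comp_braiding_tensor_inv,
        whiskerLeft_braiding_inv_comp_braiding_tensor_inv]
      simp only [assoc, Iso.hom_inv_id_assoc, ← map_comp]
    _ = _ := by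
      rw [δ_nat_left]
      simp only [deltaSharp, assoc, ← map_comp, hom_inv_whiskerRight_assoc]
end

section
/- Let C be a braided monoidal category, ⊕ : C × C → C a bifunctor, and δ_{A,B,C} : A⊗(B⊕C) ≅ (A⊗B)⊕(A⊗C) a family of isomorphisms natural in A, B, C satisfying Condition VI. Then Laplaza's Condition VIII holds: for all objects A, B, C, D of C, (1_A ⊗ δ#_{C,D,B}) ≫ δ_{A,C⊗B,D⊗B} ≫ (α_{A,C,B}⁻¹ ⊕ α_{A,D,B}⁻¹) = α_{A,C⊕D,B}⁻¹ ≫ (δ_{A,C,D} ⊗ 1_B) ≫ δ#_{A⊗C,A⊗D,B}, as morphisms A⊗((C⊕D)⊗B) → ((A⊗C)⊗B)⊕((A⊗D)⊗B). -/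
open CategoryTheory Category MonoidalCategory

/-- Commuting a tensor factor past `A ⊗ X` is commuting it past `X` and then past `A`. -/
theorem whiskerLeft_braiding_associator_inv_braiding {𝒞 : Type*} [Category 𝒞]
    [MonoidalCategory 𝒞] [BraidedCategory 𝒞] (A B X : 𝒞) :
    A ◁ (β_ X B).hom ≫ (α_ A B X).inv ≫ (β_ A B).hom ▷ X
      = (α_ A X B).inv ≫ (β_ (A ⊗ X) B).hom ≫ (α_ B A X).inv := by
  simp [BraidedCategory.braiding_tensor_left_hom]

/-- The inverse form of `whiskerLeft_braiding_associator_inv_braiding`. -/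
theorem braiding_inv_associator_whiskerLeft_braiding_inv {𝒞 : Type*} [Category 𝒞]
    [MonoidalCategory 𝒞] [BraidedCategory 𝒞] (A B X : 𝒞) :
    (β_ A B).inv ▷ X ≫ (α_ A B X).hom ≫ A ◁ (β_ X B).inv ≫ (α_ A X B).inv
      = (α_ B A X).hom ≫ (β_ (A ⊗ X) B).inv := by
  simp [BraidedCategory.braiding_tensor_left_inv]

/-- Laplaza's Condition VIII follows from Condition VI in a braided monoidal category. -/
theorem laplaza_VIII_of_VI {𝒞 : Type*} [Category 𝒞] [MonoidalCategory 𝒞] [BraidedCategory 𝒞]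
    (P : 𝒞 × 𝒞 ⥤ 𝒞)
    (δ : ∀ A B X : 𝒞, A ⊗ P.obj (B, X) ≅ P.obj (A ⊗ B, A ⊗ X))
    (δ_nat : ∀ {A A' B B' X X' : 𝒞} (a : A ⟶ A') (b : B ⟶ B') (x : X ⟶ X'),
      MonoidalCategory.tensorHom a (P.map (b, x)) ≫ (δ A' B' X').hom
        = (δ A B X).hom ≫ P.map (MonoidalCategory.tensorHom a b, MonoidalCategory.tensorHom a x))
    (condVI : ∀ A B X Y : 𝒞,
      (δ (A ⊗ B) X Y).hom ≫ P.map ((α_ A B X).hom, (α_ A B Y).hom)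
        = (α_ A B (P.obj (X, Y))).hom ≫ MonoidalCategory.tensorHom (𝟙 A) (δ B X Y).hom
            ≫ (δ A (B ⊗ X) (B ⊗ Y)).hom)
    (A B C D : 𝒞) :
    MonoidalCategory.tensorHom (𝟙 A) (deltaSharp P δ C D B)
        ≫ (δ A (C ⊗ B) (D ⊗ B)).hom
        ≫ P.map ((α_ A C B).inv, (α_ A D B).inv)
      = (α_ A (P.obj (C, D)) B).inv
          ≫ MonoidalCategory.tensorHom (δ A C D).hom (𝟙 B)
          ≫ deltaSharp P δ (A ⊗ C) (A ⊗ D) B := by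
  have map_comp : ∀ {X X' X'' Y Y' Y'' : 𝒞} (f : X ⟶ X') (g : Y ⟶ Y') (f' : X' ⟶ X'')
      (g' : Y' ⟶ Y''), P.map (X := (X, Y)) (Y := (X', Y')) (f, g)
          ≫ P.map (X := (X', Y')) (Y := (X'', Y'')) (f', g')
        = P.map (X := (X, Y)) (Y := (X'', Y'')) (f ≫ f', g ≫ g') := by
    intro X X' X'' Y Y' Y'' f g f' g'
    rw [← P.map_comp, prod_comp]
  have map_id : ∀ X Y : 𝒞, P.map (X := (X, Y)) (Y := (X, Y)) (𝟙 X, 𝟙 Y) = 𝟙 _ :=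
    fun X Y => P.map_id (X, Y)
  have nat_left : ∀ {X X' : 𝒞} (f : X ⟶ X'),
      f ▷ P.obj (C, D) ≫ (δ X' C D).hom = (δ X C D).hom ≫ P.map (f ▷ C, f ▷ D) := by
    intro X X' f
    simpa [map_id] using δ_nat f (𝟙 C) (𝟙 D)
  have nat_right : ∀ (X : 𝒞) {Y Y' Z Z' : 𝒞} (g : Y ⟶ Y') (h : Z ⟶ Z'),
      X ◁ P.map (g, h) ≫ (δ X Y' Z').hom = (δ X Y Z).hom ≫ P.map (X ◁ g, X ◁ h) := by
    intro X Y Y' Z Z' g h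
    simpa using δ_nat (𝟙 X) g h
  have sequential : ∀ X Y : 𝒞, X ◁ (δ Y C D).hom ≫ (δ X (Y ⊗ C) (Y ⊗ D)).hom
      = (α_ X Y (P.obj (C, D))).inv ≫ (δ (X ⊗ Y) C D).hom
          ≫ P.map ((α_ X Y C).hom, (α_ X Y D).hom) := by
    intro X Y
    simp [condVI]
  have conjugate : (δ (A ⊗ B) C D).hom = (β_ A B).hom ▷ P.obj (C, D) ≫ (δ (B ⊗ A) C D).hom
      ≫ P.map ((β_ A B).inv ▷ C, (β_ A B).inv ▷ D) := by
    rw [← nat_left, ← comp_whiskerRight_assoc, Iso.hom_inv_id, id_whiskerRight, id_comp]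
  simp only [deltaSharp, id_tensorHom, tensorHom_id, MonoidalCategory.whiskerLeft_comp, assoc]
  calc
    _ = A ◁ (β_ (P.obj (C, D)) B).hom ≫ (A ◁ (δ B C D).hom ≫ (δ A (B ⊗ C) (B ⊗ D)).hom)
          ≫ P.map (A ◁ (β_ C B).inv ≫ (α_ A C B).inv, A ◁ (β_ D B).inv ≫ (α_ A D B).inv) := by
      rw [reassoc_of% (nat_right A (β_ C B).inv (β_ D B).inv), map_comp, assoc]
    _ = (A ◁ (β_ (P.obj (C, D)) B).hom ≫ (α_ A B (P.obj (C, D))).inv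
            ≫ (β_ A B).hom ▷ P.obj (C, D)) ≫ (δ (B ⊗ A) C D).hom
          ≫ P.map
            ((β_ A B).inv ▷ C ≫ (α_ A B C).hom ≫ A ◁ (β_ C B).inv ≫ (α_ A C B).inv,
              (β_ A B).inv ▷ D ≫ (α_ A B D).hom ≫ A ◁ (β_ D B).inv ≫ (α_ A D B).inv) := by
      simp only [sequential, conjugate, assoc, map_comp]
    _ = (α_ A (P.obj (C, D)) B).inv ≫ (β_ (A ⊗ P.obj (C, D)) B).hom
          ≫ (B ◁ (δ A C D).hom ≫ (δ B (A ⊗ C) (A ⊗ D)).hom)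
          ≫ P.map ((β_ (A ⊗ C) B).inv, (β_ (A ⊗ D) B).inv) := by
      rw [whiskerLeft_braiding_associator_inv_braiding,
        braiding_inv_associator_whiskerLeft_braiding_inv,
        braiding_inv_associator_whiskerLeft_braiding_inv, sequential]
      simp only [assoc, map_comp]
    _ = _ := by
      rw [BraidedCategory.braiding_naturality_left_assoc, assoc]
end

section
/- Let C be a braided monoidal category, N an object of C, and ε_A : A⊗N → N a family of morphisms natural in A satisfying Condition XVIII. Then Laplaza's Condition XVII holds: for all objects A, B of C, α_{A,N,B} ≫ (1_A ⊗ γ_{B,N}⁻¹) ≫ (1_A ⊗ ε_B) ≫ ε_A = (ε_A ⊗ 1_B) ≫ γ_{B,N}⁻¹ ≫ ε_B, as morphisms (A⊗N)⊗B → N. -/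
open CategoryTheory Category MonoidalCategory

/-- Laplaza's Condition XVII follows from Condition XVIII in a braided monoidal category. -/
theorem laplaza_XVII_of_XVIII {𝒞 : Type*} [Category 𝒞] [MonoidalCategory 𝒞] [BraidedCategory 𝒞]
    (N : 𝒞) (ε : ∀ A : 𝒞, A ⊗ N ⟶ N)
    (ε_nat : ∀ {A A' : 𝒞} (a : A ⟶ A'),
      MonoidalCategory.tensorHom a (𝟙 N) ≫ ε A' = ε A)
    (condXVIII : ∀ A B : 𝒞,
      (α_ A B N).hom ≫ MonoidalCategory.tensorHom (𝟙 A) (ε B) ≫ ε A = ε (A ⊗ B))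
    (A B : 𝒞) :
    (α_ A N B).hom ≫ MonoidalCategory.tensorHom (𝟙 A) (β_ B N).inv
        ≫ MonoidalCategory.tensorHom (𝟙 A) (ε B) ≫ ε A
      = MonoidalCategory.tensorHom (ε A) (𝟙 B) ≫ (β_ B N).inv ≫ ε B := by
  have hα (X Y : 𝒞) : X ◁ ε Y ≫ ε X = (α_ X Y N).inv ≫ ε (X ⊗ Y) := by
    rw [← condXVIII, Iso.inv_hom_id_assoc, id_tensorHom]
  have hβ : ε A ▷ B ≫ (β_ B N).inv = (β_ B (A ⊗ N)).inv ≫ B ◁ ε A := by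
    rw [Iso.comp_inv_eq, assoc, BraidedCategory.braiding_naturality_right, Iso.inv_hom_id_assoc]
  have hnat : (β_ B A).inv ▷ N ≫ ε (B ⊗ A) = ε (A ⊗ B) := by
    simpa only [tensorHom_id] using ε_nat (β_ B A).inv
  simp only [id_tensorHom, tensorHom_id]
  rw [reassoc_of% hβ, hα, hα, BraidedCategory.braiding_tensor_right_inv]
  simp only [assoc, Iso.hom_inv_id_assoc, hnat]
end

section
/- Let C be a braided monoidal category, ⊕ : C × C → C a bifunctor, and δ_{A,B,C} : A⊗(B⊕C) ≅ (A⊗B)⊕(A⊗C) a family of isomorphisms natural in A, B, C satisfying the Right Distributive condition. Then the two candidate definitions of the right-distributivity morphism coincide: for all objects A, B, C of C, γ_{A⊕B,C} ≫ δ_{C,A,B} ≫ (γ_{A,C}⁻¹ ⊕ γ_{B,C}⁻¹) = γ_{C,A⊕B}⁻¹ ≫ δ_{C,A,B} ≫ (γ_{C,A} ⊕ γ_{C,B}), as morphisms (A⊕B)⊗C → (A⊗C)⊕(B⊗C). -/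
open CategoryTheory Category MonoidalCategory

/-- The two candidate definitions of the right-distributivity morphism coincide,
given the Right Distributive coherence condition (stated with the double braiding
`β_{X,Y} := γ_{X,Y} ≫ γ_{Y,X}`). -/
theorem rightDistrib_wellDefined {𝒞 : Type*} [Category 𝒞] [MonoidalCategory 𝒞]
    [BraidedCategory 𝒞]
    (P : 𝒞 × 𝒞 ⥤ 𝒞)
    (δ : ∀ A B X : 𝒞, A ⊗ P.obj (B, X) ≅ P.obj (A ⊗ B, A ⊗ X))
    (δ_nat : ∀ {A A' B B' X X' : 𝒞} (a : A ⟶ A') (b : B ⟶ B') (x : X ⟶ X'),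
      MonoidalCategory.tensorHom a (P.map (b, x)) ≫ (δ A' B' X').hom
        = (δ A B X).hom ≫ P.map (MonoidalCategory.tensorHom a b, MonoidalCategory.tensorHom a x))
    (rightDistrib : ∀ A B X : 𝒞,
      ((β_ A (P.obj (B, X))).hom ≫ (β_ (P.obj (B, X)) A).hom) ≫ (δ A B X).hom
        = (δ A B X).hom
            ≫ P.map ((β_ A B).hom ≫ (β_ B A).hom, (β_ A X).hom ≫ (β_ X A).hom))
    (A B C : 𝒞) :
    (β_ (P.obj (A, B)) C).hom ≫ (δ C A B).hom ≫ P.map ((β_ A C).inv, (β_ B C).inv)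
      = (β_ C (P.obj (A, B))).inv ≫ (δ C A B).hom ≫ P.map (((β_ C A).hom, (β_ C B).hom) : (C ⊗ A, C ⊗ B) ⟶ (A ⊗ C, B ⊗ C)) := by
  rw [← cancel_epi (β_ C (P.obj (A, B))).hom, Iso.hom_inv_id_assoc]
  have h := rightDistrib C A B =≫
    P.map (((β_ A C).inv, (β_ B C).inv) : (C ⊗ A, C ⊗ B) ⟶ (A ⊗ C, B ⊗ C))
  rw [assoc, assoc, assoc, ← P.map_comp, prod_comp, assoc, assoc,
    Iso.hom_inv_id, Iso.hom_inv_id, comp_id, comp_id] at h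
  exact h
end

section
/- The Expand 2×2 coherence condition (Laplaza Condition IX) holds in the abelian setting: for all objects A, B, C, D of C, γ_{A⊕B,C⊕D} ≫ δ_{C⊕D,A,B} ≫ (γ_{A,C⊕D}⁻¹ ⊕ γ_{B,C⊕D}⁻¹) ≫ (δ_{A,C,D} ⊕ δ_{B,C,D}) ≫ M_{A⊗C,A⊗D,B⊗C,B⊗D} = δ_{A⊕B,C,D} ≫ (γ_{A⊕B,C} ⊕ γ_{A⊕B,D}) ≫ (δ_{C,A,B} ⊕ δ_{D,A,B}) ≫ ((γ_{A,C}⁻¹ ⊕ γ_{B,C}⁻¹) ⊕ (γ_{A,D}⁻¹ ⊕ γ_{B,D}⁻¹)), as morphisms (A⊕B)⊗(C⊕D) → ((A⊗C)⊕(B⊗C))⊕((A⊗D)⊕(B⊗D)). Here M_{W,X,Y,Z} : (W⊕X)⊕(Y⊕Z) → (W⊕Y)⊕(X⊕Z) denotes the composite (α⊕_{W⊕X,Y,Z})⁻¹ ≫ (α⊕_{W,X,Y} ⊕ 1_Z) ≫ ((1_W ⊕ γ⊕_{X,Y}) ⊕ 1_Z) ≫ ((α⊕_{W,Y,X})⁻¹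 ⊕ 1_Z) ≫ α⊕_{W⊕Y,X,Z}. -/
open CategoryTheory Category Limits MonoidalCategory ZeroObject

/-- The distributivity morphism `δ_{A,B,C} : A⊗(B⊕C) ⟶ (A⊗B)⊕(A⊗C)`, the unique
morphism with `δ ≫ p₁ = 𝟙 A ⊗ p₁` and `δ ≫ p₂ = 𝟙 A ⊗ p₂`. -/
noncomputable def distrib {𝒞 : Type*} [Category 𝒞] [Abelian 𝒞] [MonoidalCategory 𝒞]
    [BraidedCategory 𝒞] [MonoidalPreadditive 𝒞] (A B X : 𝒞) :
    A ⊗ (B ⊞ X) ⟶ (A ⊗ B) ⊞ (A ⊗ X) :=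
  biprod.lift (MonoidalCategory.tensorHom (𝟙 A) biprod.fst)
    (MonoidalCategory.tensorHom (𝟙 A) biprod.snd)

/-- The middle-four exchange morphism `(W⊕X)⊕(Y⊕Z) ⟶ (W⊕Y)⊕(X⊕Z)` built from the
biproduct associators and the biproduct symmetry. -/
noncomputable def middleFour {𝒞 : Type*} [Category 𝒞] [Abelian 𝒞] (W X Y Z : 𝒞) :
    (W ⊞ X) ⊞ (Y ⊞ Z) ⟶ (W ⊞ Y) ⊞ (X ⊞ Z) :=
  (biprod.associator (W ⊞ X) Y Z).inv
    ≫ biprod.map (biprod.associator W X Y).hom (𝟙 Z)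
    ≫ biprod.map (biprod.map (𝟙 W) (biprod.braiding X Y).hom) (𝟙 Z)
    ≫ biprod.map (biprod.associator W Y X).inv (𝟙 Z)
    ≫ (biprod.associator (W ⊞ Y) X Z).hom

section

variable {𝒞 : Type*} [Category 𝒞] [Abelian 𝒞]

theorem middleFour_eq_lift (W X Y Z : 𝒞) :
    middleFour W X Y Z =
      biprod.lift (biprod.map biprod.fst biprod.fst) (biprod.map biprod.snd biprod.snd) := by
  unfold middleFour
  ext <;> simp [biprod.associator, biprod.braiding]

variable [MonoidalCategory 𝒞] [BraidedCategory 𝒞] [MonoidalPreadditive 𝒞]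

theorem distrib_fst (A B X : 𝒞) : distrib A B X ≫ biprod.fst = A ◁ biprod.fst := by
  simp [distrib]

theorem distrib_fst_assoc (A B X : 𝒞) {Z : 𝒞} (h : A ⊗ B ⟶ Z) :
    distrib A B X ≫ biprod.fst ≫ h = A ◁ biprod.fst ≫ h := by
  rw [← assoc, distrib_fst]

theorem distrib_snd (A B X : 𝒞) : distrib A B X ≫ biprod.snd = A ◁ biprod.snd := by
  simp [distrib]

theorem distrib_snd_assoc (A B X : 𝒞) {Z : 𝒞} (h : A ⊗ X ⟶ Z) :
    distrib A B X ≫ biprod.snd ≫ h = A ◁ biprod.snd ≫ h := by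
  rw [← assoc, distrib_snd]

end

/-- The Expand 2×2 coherence condition (Laplaza Condition IX) holds in the
abelian setting. -/
theorem expand_two_two {𝒞 : Type*} [Category 𝒞] [Abelian 𝒞] [MonoidalCategory 𝒞]
    [BraidedCategory 𝒞] [MonoidalPreadditive 𝒞] (A B X D : 𝒞) :
    (β_ (A ⊞ B) (X ⊞ D)).hom ≫ distrib (X ⊞ D) A B
        ≫ biprod.map (β_ A (X ⊞ D)).inv (β_ B (X ⊞ D)).inv
        ≫ biprod.map (distrib A X D) (distrib B X D)
        ≫ middleFour (A ⊗ X) (A ⊗ D) (B ⊗ X) (B ⊗ D)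
      = distrib (A ⊞ B) X D
          ≫ biprod.map (β_ (A ⊞ B) X).hom (β_ (A ⊞ B) D).hom
          ≫ biprod.map (distrib X A B) (distrib D A B)
          ≫ biprod.map (biprod.map (β_ A X).inv (β_ B X).inv)
              (biprod.map (β_ A D).inv (β_ B D).inv) := by
  rw [middleFour_eq_lift]
  apply biprod.hom_ext <;> apply biprod.hom_ext <;>
    simp only [assoc, biprod.lift_fst, biprod.lift_snd, biprod.map_fst, biprod.map_snd,
      biprod.map_fst_assoc, biprod.map_snd_assoc, distrib_fst, distrib_snd,
      distrib_fst_assoc, distrib_snd_assoc, ← BraidedCategory.braiding_naturality_left_assoc,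
      Iso.hom_inv_id, Iso.hom_inv_id_assoc, comp_id, whisker_exchange]
end
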